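/- arXiv:1505.06229 — 4 statements merged into one kernel-verified Lean document; each statement's English description precedes it below -/
import Mathlib

section
/- Let ω_1, …, ω_n be an NICF-admissible sequence satisfying |q_{m−1}| ≤ |q_m| for all 1 ≤ m ≤ n and |ω_n| ≥ 3. Then for all x, y ∈ [−1/2, 1/2] one has (q_n + y·q_{n−1})² ≤ (25/9)·(q_n + x·q_{n−1})²; equivalently, the Möbius map φ_ω = φ_{ω_1}∘⋯∘φ_{ω_n}, where φ_b(z) = 1/(b+z), satisfies the bounded distortion estimate |φ_ω′(x)| ≤ (25/9)·|φ_ω′(y)| for all x, y ∈ [−1/2, 1/2]. -/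
/-- If `|ω| ≥ 3` and `|c| ≤ |b|`, one step of the recursion at least doubles the denominator. -/
theorem two_mul_abs_le_abs_mul_add {w b c : ℤ} (hw : 3 ≤ |w|) (hcb : |c| ≤ |b|) :
    2 * |b| ≤ |w * b + c| := by
  have htri : |w * b| - |c| ≤ |w * b + c| := by
    simpa using abs_sub_abs_le_abs_sub (w * b) (-c)
  rw [abs_mul] at htri
  nlinarith [abs_nonneg b]

/-- If `2|b| ≤ |a|`, then `t ↦ (a + t b)²` varies by a factor of at most `25/9`
on `[-1/2, 1/2]`. -/
theorem sq_add_mul_le_of_two_mul_abs_le {a b x y : ℝ} (hab : 2 * |b| ≤ |a|)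
    (hx : |x| ≤ 1 / 2) (hy : |y| ≤ 1 / 2) :
    (a + y * b) ^ 2 ≤ (25 / 9) * (a + x * b) ^ 2 := by
  have hupper : |a + y * b| ≤ |a| + |y| * |b| := by
    simpa only [abs_mul] using abs_add_le a (y * b)
  have hlower : |a| - |x| * |b| ≤ |a + x * b| := by
    simpa [abs_mul] using abs_sub_abs_le_abs_sub a (-(x * b))
  have hxb : |x| * |b| ≤ 1 / 2 * |b| := by gcongr
  have hyb : |y| * |b| ≤ 1 / 2 * |b| := by gcongr
  have hratio : |a + y * b| ≤ |5 / 3 * (a + x * b)| := by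
    rw [abs_mul, abs_of_pos (by norm_num : (0 : ℝ) < 5 / 3)]
    linarith
  calc (a + y * b) ^ 2 ≤ (5 / 3 * (a + x * b)) ^ 2 := sq_le_sq.mpr hratio
    _ = (25 / 9) * (a + x * b) ^ 2 := by ring

/-- Lemma 5.3: if ω_1, …, ω_n is NICF-admissible with |q_{m−1}| ≤ |q_m| for 1 ≤ m ≤ n and
|ω_n| ≥ 3, then for all x, y ∈ [−1/2, 1/2] one has
(q_n + y·q_{n−1})² ≤ (25/9)·(q_n + x·q_{n−1})², i.e. the bounded distortion estimate
|φ_ω′(x)| ≤ (25/9)·|φ_ω′(y)| holds. -/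
theorem nicf_bounded_distortion (n : ℕ) (ω q : ℕ → ℤ) (hn : 1 ≤ n)
    (hω2 : ∀ m, 1 ≤ m → m ≤ n → 2 ≤ |ω m|)
    (hadm : ∀ m, 1 ≤ m → m < n →
      (ω m = 2 → 0 < ω (m + 1)) ∧ (ω m = -2 → ω (m + 1) < 0))
    (hq0 : q 0 = 1) (hq1 : q 1 = ω 1)
    (hrec : ∀ m, 2 ≤ m → m ≤ n → q m = ω m * q (m - 1) + q (m - 2))
    (hmono : ∀ m, 1 ≤ m → m ≤ n → |q (m - 1)| ≤ |q m|)
    (hlast : 3 ≤ |ω n|) :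
    ∀ x ∈ Set.Icc (-(1 : ℝ) / 2) (1 / 2), ∀ y ∈ Set.Icc (-(1 : ℝ) / 2) (1 / 2),
      ((q n : ℝ) + y * q (n - 1)) ^ 2 ≤ (25 / 9) * ((q n : ℝ) + x * q (n - 1)) ^ 2 := by
  intro x hx y hy
  have hdouble : 2 * |q (n - 1)| ≤ |q n| := by
    rcases hn.eq_or_lt with rfl | hn2
    · simp only [Nat.sub_self, hq0, hq1, abs_one]
      linarith
    · rw [hrec n hn2 le_rfl]
      exact two_mul_abs_le_abs_mul_add hlast (hmono (n - 1) (by omega) (by omega))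
  refine sq_add_mul_le_of_two_mul_abs_le (by exact_mod_cast hdouble)
    (abs_le.mpr ⟨?_, hx.2⟩) (abs_le.mpr ⟨?_, hy.2⟩)
  · linarith [hx.1]
  · linarith [hy.1]
end

section
/- Let Φ = {φ_e}_{e∈E} be a CIFS on X, let F ⊆ E and e ∈ E. Suppose M_e > 0 is such that ‖φ′_{ω e ω̄}‖ ≤ M_e·‖φ′_{ω ω̄}‖ for all finite words ω over F and ω̄ over F ∪ {e} (where ω e ω̄ and ω ω̄ denote concatenations). Then for every t ≥ 0, λ_F(t) ≤ λ_{F∪{e}}(t) ≤ λ_F(t) + M_e^t. -/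
open scoped ENNReal

/-- A one-dimensional conformal iterated function system (CIFS) on a nondegenerate compact
interval `X ⊂ ℝ` with countable alphabet `E`: injective contractions `φ e : X → X` with a
common contraction ratio `s < 1`, extending to C¹ maps with nowhere-vanishing derivative on
a fixed open interval `W ⊃ X`, satisfying the open set condition and a Hölder distortion
condition on the derivatives. -/
structure CIFS (E : Type*) where
  X : Set ℝ
  hX : ∃ a b : ℝ, a < b ∧ X = Set.Icc a b
  W : Set ℝ
  hWopen : IsOpen W
  hWconn : W.OrdConnected
  hXW : X ⊆ W
  φ : E → ℝ → ℝ
  s : ℝ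
  hs0 : 0 ≤ s
  hs1 : s < 1
  maps : ∀ e, Set.MapsTo (φ e) X X
  inj : ∀ e, Set.InjOn (φ e) X
  contract : ∀ e, ∀ x ∈ X, ∀ y ∈ X, |φ e x - φ e y| ≤ s * |x - y|
  smooth : ∀ e, ContDiffOn ℝ 1 (φ e) W
  deriv_ne : ∀ e, ∀ x ∈ W, deriv (φ e) x ≠ 0
  osc : ∀ e f, e ≠ f → Disjoint (φ e '' interior X) (φ f '' interior X)
  L : ℝ
  hL : 1 ≤ L
  β : ℝ
  hβ : 0 < β
  holder : ∀ e, ∀ x ∈ W, ∀ y ∈ W,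
    ‖|deriv (φ e) y| - |deriv (φ e) x|‖ ≤ L * (⨅ z : W, |deriv (φ e) z|) * |y - x| ^ β

namespace CIFS

variable {E : Type*} (S : CIFS E)

/-- The map `φ_ω = φ_{ω_1} ∘ ⋯ ∘ φ_{ω_n}` coded by a finite word `ω`. -/
noncomputable def wordMap (w : List E) : ℝ → ℝ :=
  w.foldr (fun e f => S.φ e ∘ f) id

/-- `‖φ'_ω‖ = sup_{x ∈ X} |φ'_ω(x)|`. -/
noncomputable def wnorm (w : List E) : ℝ :=
  ⨆ x : S.X, |deriv (S.wordMap w) x|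

/-- `Z_{n,F}(t) = Σ_{ω ∈ F^n} ‖φ'_ω‖^t ∈ [0,∞]`. -/
noncomputable def Z (F : Set E) (t : ℝ) (n : ℕ) : ℝ≥0∞ :=
  ∑' w : {w : List E // w.length = n ∧ ∀ e ∈ w, e ∈ F}, ENNReal.ofReal (S.wnorm w ^ t)

/-- `λ_F(t) = lim_n Z_{n,F}(t)^{1/n}` (the limit exists by submultiplicativity, so it
coincides with the limit superior used here). -/
noncomputable def lam (F : Set E) (t : ℝ) : ℝ≥0∞ :=
  Filter.atTop.limsup fun n : ℕ => (S.Z F t n) ^ ((n : ℝ)⁻¹)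

/-- The limit set `J_F = ∪_{ω ∈ F^ℕ} ∩_{n ≥ 1} φ_{ω_1⋯ω_n}(X)`. -/
noncomputable def limitSet (F : Set E) : Set ℝ :=
  {x | ∃ ω : ℕ → E, (∀ k, ω k ∈ F) ∧
    ∀ n, 1 ≤ n → x ∈ S.wordMap ((List.range n).map ω) '' S.X}

end CIFS

open Filter Topology

namespace CIFS

section WordSums

variable {E : Type*}

/-- The sum of `f` over all words of length `n` with letters in `G`. -/
noncomputable def wordSum (G : Set E) (f : List E → ℝ≥0∞) (n : ℕ) : ℝ≥0∞ :=
  ∑' w : {w : List E // w.length = n ∧ ∀ a ∈ w, a ∈ G}, f w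

lemma wordSum_mono_set {F G : Set E} (hFG : F ⊆ G) (f : List E → ℝ≥0∞) (n : ℕ) :
    wordSum F f n ≤ wordSum G f n :=
  ENNReal.tsum_comp_le_tsum_of_injective
    (f := fun w : {w : List E // w.length = n ∧ ∀ a ∈ w, a ∈ F} =>
      (⟨w.1, w.2.1, fun a ha => hFG (w.2.2 a ha)⟩ :
        {w : List E // w.length = n ∧ ∀ a ∈ w, a ∈ G}))
    (fun _ _ huv => Subtype.ext (by simpa using huv)) (fun w => f w)

lemma wordSum_zero (G : Set E) (f : List E → ℝ≥0∞) : wordSum G f 0 = f [] := by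
  unfold wordSum
  rw [tsum_eq_single ⟨[], by simp⟩]
  rintro ⟨w, hw⟩ hne
  exact absurd (Subtype.ext (List.length_eq_zero_iff.mp hw.1)) hne

/-- Splitting off the first letter of a word. -/
def wordConsEquiv (G : Set E) (n : ℕ) :
    (Σ _ : G, {w : List E // w.length = n ∧ ∀ a ∈ w, a ∈ G}) ≃
      {w : List E // w.length = n + 1 ∧ ∀ a ∈ w, a ∈ G} where
  toFun p := ⟨p.1.1 :: p.2.1, by simp [p.2.2.1], by
    simpa using fun a ha => p.2.2.2 a ha⟩
  invFun w := match w with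
    | ⟨a :: v, hw⟩ => ⟨⟨a, hw.2 a (by simp)⟩, ⟨v, by simpa using hw.1, fun b hb =>
        hw.2 b (by simp [hb])⟩⟩
  left_inv _ := rfl
  right_inv := by
    rintro ⟨_ | ⟨a, v⟩, hw⟩
    · simp at hw
    · rfl

lemma wordSum_succ (G : Set E) (f : List E → ℝ≥0∞) (n : ℕ) :
    wordSum G f (n + 1) = ∑' a : G, wordSum G (fun w => f (a :: w)) n := by
  unfold wordSum
  rw [← (wordConsEquiv G n).tsum_eq]
  exact ENNReal.tsum_sigma' _

/-- The binomial transform `n ↦ ∑ₖ (n choose k) m ^ k u (n - k)`, defined recursively. -/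
noncomputable def binomialTransform (m : ℝ≥0∞) : ℕ → (ℕ → ℝ≥0∞) → ℝ≥0∞
  | 0, u => u 0
  | n + 1, u => binomialTransform m n (fun j => u (j + 1)) + m * binomialTransform m n u

lemma binomialTransform_mono (m : ℝ≥0∞) (n : ℕ) {u v : ℕ → ℝ≥0∞} (huv : ∀ j, u j ≤ v j) :
    binomialTransform m n u ≤ binomialTransform m n v := by
  induction n generalizing u v with
  | zero => exact huv 0
  | succ n ih => exact add_le_add (ih fun j => huv (j + 1)) (mul_le_mul_right (ih huv) m)

lemma binomialTransform_tsum {ι : Type*} (m : ℝ≥0∞) (n : ℕ) (u : ι → ℕ → ℝ≥0∞) :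
    ∑' i, binomialTransform m n (u i) = binomialTransform m n (fun j => ∑' i, u i j) := by
  induction n generalizing u with
  | zero => rfl
  | succ n ih =>
    simp only [binomialTransform]
    rw [ENNReal.tsum_add, ENNReal.tsum_mul_left, ih, ih]

lemma binomialTransform_geometric (m C μ : ℝ≥0∞) (n : ℕ) :
    binomialTransform m n (fun j => C * μ ^ j) = C * (μ + m) ^ n := by
  induction n generalizing C with
  | zero => simp [binomialTransform]
  | succ n ih =>
    have hshift : (fun j => C * μ ^ (j + 1)) = fun j => C * μ * μ ^ j := by
      funext j; ring
    simp only [binomialTransform, hshift, ih]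
    ring

lemma wordSum_union_singleton_le (F : Set E) (e : E) (m : ℝ≥0∞) (n : ℕ) (f : List E → ℝ≥0∞)
    (hf : ∀ ω ω' : List E, (∀ a ∈ ω, a ∈ F) → (∀ a ∈ ω', a ∈ F ∪ {e}) →
      f (ω ++ e :: ω') ≤ m * f (ω ++ ω')) :
    wordSum (F ∪ {e}) f n ≤ binomialTransform m n (wordSum F f) := by
  induction n generalizing f with
  | zero => simp [wordSum_zero, binomialTransform]
  | succ n ih =>
    rw [wordSum_succ]
    refine (ENNReal.tsum_union_le (fun a => wordSum (F ∪ {e}) (fun w => f (a :: w)) n)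
      F {e}).trans ?_
    refine add_le_add ?_ ?_
    · have hshift : (fun j => wordSum F f (j + 1)) =
          fun j => ∑' a : F, wordSum F (fun w => f (a :: w)) j :=
        funext fun j => wordSum_succ F f j
      rw [hshift, ← binomialTransform_tsum]
      refine ENNReal.tsum_le_tsum fun a => ih _ fun ω ω' hω hω' => ?_
      refine hf (a :: ω) ω' (fun b hb => ?_) hω'
      rcases List.mem_cons.mp hb with rfl | hb
      · exact a.2
      · exact hω b hb
    · rw [tsum_singleton e fun a => wordSum (F ∪ {e}) (fun w => f (a :: w)) n]
      calc wordSum (F ∪ {e}) (fun w => f (e :: w)) n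
          ≤ m * wordSum (F ∪ {e}) f n := by
            unfold wordSum
            rw [← ENNReal.tsum_mul_left]
            exact ENNReal.tsum_le_tsum fun w => hf [] w (by simp) w.2.2
        _ ≤ m * binomialTransform m n (wordSum F f) := mul_le_mul_right (ih f hf) m

end WordSums

section Growth

lemma exists_le_mul_pow {u : ℕ → ℝ≥0∞} (hu : ∀ n, u n ≠ ∞) {μ : ℝ≥0∞} (hμ0 : μ ≠ 0)
    (hμ : μ ≠ ∞) (hlim : limsup (fun n : ℕ => u n ^ ((n : ℝ)⁻¹)) atTop < μ) :
    ∃ C : ℝ≥0∞, C ≠ 0 ∧ C ≠ ∞ ∧ ∀ n, u n ≤ C * μ ^ n := by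
  obtain ⟨N, hN⟩ := eventually_atTop.mp (eventually_lt_of_limsup_lt hlim)
  refine ⟨1 + ∑ j ∈ Finset.range (N + 1), u j / μ ^ j, by simp, ?_, fun n => ?_⟩
  · refine ENNReal.add_ne_top.mpr ⟨by simp, ENNReal.sum_ne_top.mpr fun j _ => ?_⟩
    exact ENNReal.div_ne_top (hu j) (pow_ne_zero j hμ0)
  · rcases lt_or_ge n (N + 1) with hn | hn
    · calc u n = u n / μ ^ n * μ ^ n :=
            (ENNReal.div_mul_cancel (pow_ne_zero n hμ0) (ENNReal.pow_ne_top hμ)).symm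
        _ ≤ _ := by
            gcongr
            exact (Finset.single_le_sum (f := fun j => u j / μ ^ j) (fun _ _ => zero_le)
              (Finset.mem_range.mpr hn)).trans le_add_self
    · have hn0 : n ≠ 0 := by omega
      calc u n = (u n ^ ((n : ℝ)⁻¹)) ^ n := by
            rw [← ENNReal.rpow_natCast, ENNReal.rpow_inv_rpow (by exact_mod_cast hn0)]
        _ ≤ 1 * μ ^ n := by
            rw [one_mul]
            exact pow_le_pow_left₀ zero_le (hN n (by omega)).le n
        _ ≤ _ := by gcongr; exact le_self_add

lemma limsup_root_le_of_le_mul_pow {u : ℕ → ℝ≥0∞} {C ρ : ℝ≥0∞} (hC0 : C ≠ 0) (hC : C ≠ ∞)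
    (hu : ∀ n, u n ≤ C * ρ ^ n) :
    limsup (fun n : ℕ => u n ^ ((n : ℝ)⁻¹)) atTop ≤ ρ := by
  have hCroot : Tendsto (fun n : ℕ => C ^ ((n : ℝ)⁻¹)) atTop (𝓝 1) := by
    lift C to NNReal using hC
    have hC0 : C ≠ 0 := by simpa using hC0
    simp_rw [← ENNReal.coe_rpow_of_ne_zero hC0]
    rw [← ENNReal.coe_one, ENNReal.tendsto_coe]
    have hinv : Tendsto (fun n : ℕ => (n : ℝ)⁻¹) atTop (𝓝 0) :=
      tendsto_inv_atTop_zero.comp tendsto_natCast_atTop_atTop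
    simpa using tendsto_const_nhds.nnrpow hinv (Or.inl hC0)
  have hlim : Tendsto (fun n : ℕ => C ^ ((n : ℝ)⁻¹) * ρ) atTop (𝓝 ρ) := by
    simpa using ENNReal.Tendsto.mul_const hCroot (Or.inl one_ne_zero)
  rw [← hlim.limsup_eq]
  refine limsup_le_limsup ?_
  filter_upwards [eventually_ne_atTop 0] with n hn
  calc u n ^ ((n : ℝ)⁻¹) ≤ (C * ρ ^ n) ^ ((n : ℝ)⁻¹) :=
        ENNReal.rpow_le_rpow (hu n) (by positivity)
    _ = C ^ ((n : ℝ)⁻¹) * ρ := by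
        rw [ENNReal.mul_rpow_of_nonneg _ _ (by positivity), ← ENNReal.rpow_natCast,
          ENNReal.rpow_rpow_inv (by exact_mod_cast hn)]

end Growth

section Derivatives

variable {E : Type*} (S : CIFS E)

lemma mapsTo_wordMap (w : List E) : Set.MapsTo (S.wordMap w) S.X S.X := by
  induction w with
  | nil => exact Set.mapsTo_id _
  | cons a w ih => exact (S.maps a).comp ih

lemma differentiableAt_φ (a : E) {x : ℝ} (hx : x ∈ S.X) : DifferentiableAt ℝ (S.φ a) x :=
  ((S.smooth a).differentiableOn one_ne_zero).differentiableAt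
    (S.hWopen.mem_nhds (S.hXW hx))

lemma differentiableAt_wordMap (w : List E) {x : ℝ} (hx : x ∈ S.X) :
    DifferentiableAt ℝ (S.wordMap w) x := by
  induction w with
  | nil => exact differentiableAt_id
  | cons a w ih => exact (S.differentiableAt_φ a (S.mapsTo_wordMap w hx)).comp x ih

lemma deriv_wordMap_cons (a : E) (w : List E) {x : ℝ} (hx : x ∈ S.X) :
    deriv (S.wordMap (a :: w)) x = deriv (S.φ a) (S.wordMap w x) * deriv (S.wordMap w) x :=
  deriv_comp x (S.differentiableAt_φ a (S.mapsTo_wordMap w hx)) (S.differentiableAt_wordMap w hx)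

lemma isCompact_X : IsCompact S.X := by
  obtain ⟨a, b, -, hX⟩ := S.hX
  rw [hX]
  exact isCompact_Icc

lemma nonempty_X : S.X.Nonempty := by
  obtain ⟨a, b, hab, hX⟩ := S.hX
  rw [hX]
  exact Set.nonempty_Icc.mpr hab.le

lemma continuousOn_abs_deriv_φ (a : E) : ContinuousOn (fun x => |deriv (S.φ a) x|) S.X :=
  (((S.smooth a).continuousOn_deriv_of_isOpen S.hWopen le_rfl).mono S.hXW).abs

lemma bddAbove_abs_deriv_wordMap (w : List E) :
    ∃ C : ℝ, ∀ x ∈ S.X, |deriv (S.wordMap w) x| ≤ C := by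
  induction w with
  | nil => exact ⟨1, fun x _ => by simp [wordMap]⟩
  | cons a w ih =>
    obtain ⟨C, hC⟩ := ih
    obtain ⟨D, hD⟩ := S.isCompact_X.bddAbove_image (S.continuousOn_abs_deriv_φ a)
    refine ⟨D * C, fun x hx => ?_⟩
    have hDx := hD (Set.mem_image_of_mem _ (S.mapsTo_wordMap w hx))
    rw [S.deriv_wordMap_cons a w hx, abs_mul]
    exact mul_le_mul hDx (hC x hx) (abs_nonneg _) ((abs_nonneg _).trans hDx)

lemma wnorm_nonneg (w : List E) : 0 ≤ S.wnorm w := Real.iSup_nonneg fun _ => abs_nonneg _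

/-- Prepending a fixed letter shrinks the norm by at most a positive factor. -/
lemma exists_mul_wnorm_le_wnorm_cons (a : E) :
    ∃ c : ℝ, 0 < c ∧ ∀ w, c * S.wnorm w ≤ S.wnorm (a :: w) := by
  obtain ⟨x₀, hx₀, hmin⟩ := S.isCompact_X.exists_isMinOn S.nonempty_X
    (S.continuousOn_abs_deriv_φ a)
  refine ⟨|deriv (S.φ a) x₀|, abs_pos.mpr (S.deriv_ne a x₀ (S.hXW hx₀)), fun w => ?_⟩
  have : Nonempty S.X := S.nonempty_X.to_subtype
  obtain ⟨C, hC⟩ := S.bddAbove_abs_deriv_wordMap (a :: w)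
  have hbdd : BddAbove (Set.range fun x : S.X => |deriv (S.wordMap (a :: w)) x|) :=
    ⟨C, by rintro _ ⟨x, rfl⟩; exact hC x x.2⟩
  unfold wnorm
  rw [Real.mul_iSup_of_nonneg (abs_nonneg _)]
  refine ciSup_mono hbdd fun x => ?_
  rw [S.deriv_wordMap_cons a w x.2, abs_mul]
  exact mul_le_mul_of_nonneg_right (hmin (S.mapsTo_wordMap w x.2)) (abs_nonneg _)

end Derivatives

variable {E : Type*} (S : CIFS E)

lemma Z_eq_wordSum (F : Set E) (t : ℝ) (n : ℕ) :
    S.Z F t n = wordSum F (fun w => ENNReal.ofReal (S.wnorm w ^ t)) n := rfl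

lemma lam_mono {F G : Set E} (hFG : F ⊆ G) (t : ℝ) : S.lam F t ≤ S.lam G t :=
  limsup_le_limsup <| Eventually.of_forall fun n =>
    ENNReal.rpow_le_rpow (wordSum_mono_set hFG (fun w => ENNReal.ofReal (S.wnorm w ^ t)) n)
      (by positivity)

lemma Z_succ_eq_top {F : Set E} (hF : F.Nonempty) {t : ℝ} (ht : 0 ≤ t) {n : ℕ}
    (hn : S.Z F t n = ∞) : S.Z F t (n + 1) = ∞ := by
  obtain ⟨a, ha⟩ := hF
  obtain ⟨c, hc, hcw⟩ := S.exists_mul_wnorm_le_wnorm_cons a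
  have hct : ENNReal.ofReal (c ^ t) ≠ 0 := by
    simpa using Real.rpow_pos_of_pos hc t
  rw [eq_top_iff, Z_eq_wordSum, wordSum_succ]
  calc ∞ = ENNReal.ofReal (c ^ t) * S.Z F t n := by rw [hn, ENNReal.mul_top hct]
    _ ≤ wordSum F (fun w => ENNReal.ofReal (S.wnorm (a :: w) ^ t)) n := by
        rw [Z_eq_wordSum]
        unfold wordSum
        rw [← ENNReal.tsum_mul_left]
        refine ENNReal.tsum_le_tsum fun w => ?_
        rw [← ENNReal.ofReal_mul (Real.rpow_nonneg hc.le t),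
          ← Real.mul_rpow hc.le (S.wnorm_nonneg _)]
        exact ENNReal.ofReal_le_ofReal (Real.rpow_le_rpow
          (mul_nonneg hc.le (S.wnorm_nonneg _)) (hcw _) ht)
    _ ≤ _ := ENNReal.le_tsum
        (f := fun a : F => wordSum F (fun w => ENNReal.ofReal (S.wnorm (a :: w) ^ t)) n) ⟨a, ha⟩

lemma Z_ne_top_of_lam_ne_top {F : Set E} {t : ℝ} (ht : 0 ≤ t) (hlam : S.lam F t ≠ ∞) (n : ℕ) :
    S.Z F t n ≠ ∞ := by
  intro hn
  rcases F.eq_empty_or_nonempty with rfl | hF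
  · cases n with
    | zero => simp [Z_eq_wordSum, wordSum_zero] at hn
    | succ n => simp [Z_eq_wordSum, wordSum_succ] at hn
  · have htop : ∀ k, n ≤ k → S.Z F t k = ∞ := fun k hk =>
      Nat.le_induction hn (fun _ _ ih => S.Z_succ_eq_top hF ht ih) k hk
    refine hlam ?_
    have hev : (fun k : ℕ => S.Z F t k ^ ((k : ℝ)⁻¹)) =ᶠ[atTop] fun _ => ∞ := by
      filter_upwards [eventually_ge_atTop n, eventually_gt_atTop 0] with k hk hk0
      rw [htop k hk, ENNReal.top_rpow_of_pos (by positivity)]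
    exact (limsup_congr hev).trans (limsup_const ∞)

end CIFS

/-- Theorem 4.1: if `M_e > 0` satisfies `‖φ'_{ω e ω̄}‖ ≤ M_e ‖φ'_{ω ω̄}‖` for all words `ω`
over `F` and `ω̄` over `F ∪ {e}`, then `λ_F(t) ≤ λ_{F∪{e}}(t) ≤ λ_F(t) + M_e^t`. -/
theorem CIFS.lam_add_letter_upper {E : Type*} (S : CIFS E) (F : Set E) (e : E)
    (M : ℝ) (hM : 0 < M)
    (h : ∀ ω ω' : List E, (∀ a ∈ ω, a ∈ F) → (∀ a ∈ ω', a ∈ F ∪ {e}) →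
      S.wnorm (ω ++ e :: ω') ≤ M * S.wnorm (ω ++ ω')) :
    ∀ t : ℝ, 0 ≤ t →
      S.lam F t ≤ S.lam (F ∪ {e}) t ∧
      S.lam (F ∪ {e}) t ≤ S.lam F t + ENNReal.ofReal (M ^ t) := by
  intro t ht
  refine ⟨S.lam_mono Set.subset_union_left t, ?_⟩
  refine ENNReal.le_of_forall_pos_le_add fun ε hε hfin => ?_
  have hlam : S.lam F t ≠ ∞ := (ENNReal.add_lt_top.mp hfin).1.ne
  have hε0 : (ε : ℝ≥0∞) ≠ 0 := by simpa using hε.ne'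
  obtain ⟨C, hC0, hC, hZ⟩ := exists_le_mul_pow (S.Z_ne_top_of_lam_ne_top ht hlam)
    (μ := S.lam F t + ε) (by simp [hε.ne']) (by simp [hlam])
    (ENNReal.lt_add_right hlam hε0)
  rw [add_right_comm]
  refine limsup_root_le_of_le_mul_pow hC0 hC fun n => ?_
  rw [← binomialTransform_geometric]
  refine le_trans (wordSum_union_singleton_le F e (ENNReal.ofReal (M ^ t)) n
    (fun w => ENNReal.ofReal (S.wnorm w ^ t)) fun ω ω' hω hω' => ?_)
    (binomialTransform_mono _ n hZ)
  rw [← ENNReal.ofReal_mul (Real.rpow_nonneg hM.le t), ← Real.mul_rpow hM.le (S.wnorm_nonneg _)]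
  exact ENNReal.ofReal_le_ofReal
    (Real.rpow_le_rpow (S.wnorm_nonneg _) (h ω ω' hω hω') ht)
end

section
/- Let Φ = {φ_e}_{e∈ℕ} be a CIFS on X indexed by the natural numbers with dim_H(J_ℕ) ≤ 1. Fix b ∈ ℕ and set S_b = {1, 2, …, b−1} and L_b = {b+1, b+2, …}. Suppose there exist positive constants M_b and (m_c)_{c>b} such that: ‖φ′_{ω b ω̄}‖ ≤ M_b·‖φ′_{ω ω̄}‖ for all finite words ω over S_b and ω̄ over S_b ∪ {b}; ‖φ′_{ω c ω̄}‖ ≥ m_c·‖φ′_{ω ω̄}‖ for every c > b and all finite words ω, ω̄ over ℕ; and M_b < Σ_{c=b+1}^∞ m_c. Then λ_{F∪{b}}(t) ≤ λ_{F∪L_b}(t) for every F ⊆ S_b and every t with 0 < t ≤ dim_H(J_ℕ). -/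
open scoped ENNReal

/-- The words of length `n` over the alphabet `A`. -/
abbrev WordsOver {E : Type*} (A : Set E) (n : ℕ) : Type _ :=
  {w : List E // w.length = n ∧ ∀ e ∈ w, e ∈ A}

/-- A word of length `n + 1` is a first letter followed by a word of length `n`. -/
def WordsOver.consEquiv {E : Type*} (A : Set E) (n : ℕ) :
    A × WordsOver A n ≃ WordsOver A (n + 1) where
  toFun q := ⟨q.1 :: q.2, by simp [q.2.2.1], by
    intro e he
    rcases List.mem_cons.1 he with rfl | he
    · exact q.1.2
    · exact q.2.2.2 e he⟩
  invFun
    | ⟨[], h⟩ => absurd h.1 (by simp)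
    | ⟨a :: w, h⟩ => (⟨a, h.2 a (by simp)⟩, ⟨w, by simpa using h.1,
        fun e he => h.2 e (List.mem_cons_of_mem a he)⟩)
  left_inv _ := rfl
  right_inv
    | ⟨[], h⟩ => absurd h.1 (by simp)
    | ⟨_ :: _, _⟩ => rfl

theorem WordsOver.tsum_zero {E : Type*} (A : Set E) (h : List E → ℝ≥0∞) :
    ∑' w : WordsOver A 0, h w = h [] := by
  rw [tsum_eq_single (⟨[], by simp⟩ : WordsOver A 0)]
  rintro ⟨w, hw⟩ hne
  exact absurd (Subtype.ext (List.length_eq_zero_iff.1 hw.1)) hne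

theorem WordsOver.tsum_succ {E : Type*} (A : Set E) (n : ℕ) (h : List E → ℝ≥0∞) :
    ∑' w : WordsOver A (n + 1), h w = ∑' a : A, ∑' w : WordsOver A n, h (a :: w) := by
  rw [← (WordsOver.consEquiv A n).tsum_eq]
  exact ENNReal.tsum_prod (f := fun (a : A) (w : WordsOver A n) => h (a :: w))

/-- Subadditivity of `x ↦ x ^ t` for `0 < t ≤ 1`, for infinite sums. -/
theorem ENNReal.rpow_tsum_le_tsum_rpow {ι : Type*} (f : ι → ℝ≥0∞) {t : ℝ} (ht : 0 < t)
    (ht1 : t ≤ 1) : (∑' i, f i) ^ t ≤ ∑' i, f i ^ t := by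
  have hfin : ∀ s : Finset ι, (∑ i ∈ s, f i) ^ t ≤ ∑ i ∈ s, f i ^ t := fun s =>
    Finset.le_sum_of_subadditive (fun x : ℝ≥0∞ => x ^ t) (ENNReal.zero_rpow_of_pos ht).le
      (fun x y => ENNReal.rpow_add_le_add_rpow x y ht.le ht1) s f
  rw [← ENNReal.le_rpow_inv_iff ht, ENNReal.tsum_eq_iSup_sum]
  refine iSup_le fun s => (ENNReal.le_rpow_inv_iff ht).2 ?_
  exact (hfin s).trans (ENNReal.sum_le_tsum s)

/-- If deleting the first `b` of a word costs at most a factor `K`, then deleting every `b`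
costs at most `K` to the number of occurrences of `b`. -/
theorem weight_le_pow_count_mul_filter {E : Type*} [DecidableEq E] {g : List E → ℝ≥0∞}
    {P : Set E} {b : E} {K : ℝ≥0∞}
    (hg : ∀ p w : List E, (∀ a ∈ p, a ∈ P) → (∀ a ∈ w, a ∈ P ∪ {b}) →
      g (p ++ b :: w) ≤ K * g (p ++ w))
    (w p : List E) (hp : ∀ a ∈ p, a ∈ P) (hw : ∀ a ∈ w, a ∈ P ∪ {b}) :
    g (p ++ w) ≤ K ^ w.count b * g (p ++ w.filter (· ≠ b)) := by
  induction w generalizing p with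
  | nil => simp
  | cons a w ih =>
    have hw' : ∀ a ∈ w, a ∈ P ∪ {b} := fun x hx => hw x (List.mem_cons_of_mem a hx)
    by_cases hab : a = b
    · subst hab
      calc g (p ++ a :: w) ≤ K * g (p ++ w) := hg p w hp hw'
        _ ≤ K * (K ^ w.count a * g (p ++ w.filter (· ≠ a))) := by gcongr; exact ih p hp hw'
        _ = _ := by simp [pow_succ']; ring
    · have ha : a ∈ P := (hw a (by simp)).resolve_right hab
      have := ih (p ++ [a]) (by
        intro x hx
        rcases List.mem_append.1 hx with hx | hx
        · exact hp x hx
        · rw [List.mem_singleton.1 hx]; exact ha) hw'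
      simpa [hab, List.count_cons_of_ne] using this

/-- Summing over all ways of filling each occurrence of `b` by a letter of `C` recovers at
least the factor `K` per occurrence. -/
theorem tsum_pow_count_mul_filter_le {E : Type*} [DecidableEq E] {g : List E → ℝ≥0∞}
    {F C : Set E} {b : E} {K : ℝ≥0∞} {μ : E → ℝ≥0∞} (hbF : b ∉ F) (hFC : Disjoint F C)
    (hg : ∀ c ∈ C, ∀ p w : List E, μ c * g (p ++ w) ≤ g (p ++ c :: w))
    (hK : K ≤ ∑' c : C, μ c) (n : ℕ) (p : List E) :
    ∑' w : WordsOver (F ∪ {b}) n, K ^ w.1.count b * g (p ++ w.1.filter (· ≠ b)) ≤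
      ∑' w : WordsOver (F ∪ C) n, g (p ++ w) := by
  induction n generalizing p with
  | zero =>
    rw [WordsOver.tsum_zero _ fun w => K ^ w.count b * g (p ++ w.filter (· ≠ b)),
      WordsOver.tsum_zero _ fun w => g (p ++ w)]
    simp
  | succ n ih =>
    rw [WordsOver.tsum_succ _ _ fun w => K ^ w.count b * g (p ++ w.filter (· ≠ b)),
      WordsOver.tsum_succ _ _ fun w => g (p ++ w),
      ENNReal.summable.tsum_union_disjoint (f := fun a => ∑' w : WordsOver (F ∪ {b}) n,
        K ^ (a :: w.1).count b * g (p ++ (a :: w.1).filter (· ≠ b)))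
        (Set.disjoint_singleton_right.2 hbF) ENNReal.summable,
      ENNReal.summable.tsum_union_disjoint
        (f := fun a => ∑' w : WordsOver (F ∪ C) n, g (p ++ a :: w.1)) hFC ENNReal.summable]
    have hstep : ∀ a : E, ∑' w : WordsOver (F ∪ {b}) n,
        K ^ w.1.count b * g (p ++ a :: w.1.filter (· ≠ b)) ≤
          ∑' w : WordsOver (F ∪ C) n, g (p ++ a :: w.1) := fun a => by
      simpa using ih (p ++ [a])
    refine add_le_add (ENNReal.tsum_le_tsum fun a => ?_) ?_
    · have hab : (a : E) ≠ b := fun h => hbF (h ▸ a.2)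
      simpa [hab] using hstep a
    · rw [tsum_singleton b fun a => ∑' w : WordsOver (F ∪ {b}) n,
        K ^ (a :: w.1).count b * g (p ++ (a :: w.1).filter (· ≠ b))]
      refine le_trans ?_ (ENNReal.tsum_le_tsum fun c : C => hstep c)
      rw [ENNReal.tsum_comm]
      refine ENNReal.tsum_le_tsum fun w => ?_
      rw [ENNReal.tsum_mul_left]
      calc K ^ (b :: w.1).count b * g (p ++ (b :: w.1).filter (· ≠ b))
          = K ^ w.1.count b * (K * g (p ++ w.1.filter (· ≠ b))) := by simp [pow_succ, mul_assoc]
        _ ≤ K ^ w.1.count b * ((∑' c : C, μ c) * g (p ++ w.1.filter (· ≠ b))) := by gcongr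
        _ ≤ _ := by
          rw [← ENNReal.tsum_mul_right]
          gcongr with c
          exact hg c c.2 _ _

theorem CIFS.wnorm_nonneg_s14 {E : Type*} (S : CIFS E) (w : List E) : 0 ≤ S.wnorm w :=
  Real.iSup_nonneg fun _ => abs_nonneg _

/-- Theorem 4.5: let `Φ = {φ_e}_{e ∈ ℕ⁺}` be a CIFS indexed by `{1, 2, 3, …}` with
`dim_H(J_ℕ) ≤ 1`. Fix `b`, set `S_b = {1, …, b−1}` and `L_b = {b+1, b+2, …}`. If there are
positive constants `M_b` and `(m_c)_{c > b}` such that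
`‖φ'_{ω b ω̄}‖ ≤ M_b ‖φ'_{ω ω̄}‖` for all words `ω` over `S_b` and `ω̄` over `S_b ∪ {b}`,
`‖φ'_{ω c ω̄}‖ ≥ m_c ‖φ'_{ω ω̄}‖` for all `c > b` and all words `ω, ω̄`, and
`M_b < Σ_{c>b} m_c`, then `λ_{F∪{b}}(t) ≤ λ_{F∪L_b}(t)` for every `F ⊆ S_b` and every
`0 < t ≤ dim_H(J_ℕ)`. -/
theorem CIFS.lam_exchange_letter (S : CIFS ℕ+)
    (hdim : dimH (S.limitSet Set.univ) ≤ 1)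
    (b : ℕ+) (M : ℝ) (m : ℕ+ → ℝ) (hM : 0 < M) (hm : ∀ c, b < c → 0 < m c)
    (hMb : ∀ ω ω' : List ℕ+, (∀ a ∈ ω, a ∈ Set.Iio b) →
      (∀ a ∈ ω', a ∈ Set.Iio b ∪ {b}) →
      S.wnorm (ω ++ b :: ω') ≤ M * S.wnorm (ω ++ ω'))
    (hmc : ∀ c : ℕ+, b < c → ∀ ω ω' : List ℕ+,
      m c * S.wnorm (ω ++ ω') ≤ S.wnorm (ω ++ c :: ω'))
    (hsum : ENNReal.ofReal M < ∑' c : {c : ℕ+ // b < c}, ENNReal.ofReal (m c)) :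
    ∀ F : Set ℕ+, F ⊆ Set.Iio b → ∀ t : ℝ, 0 < t →
      ENNReal.ofReal t ≤ dimH (S.limitSet Set.univ) →
      S.lam (F ∪ {b}) t ≤ S.lam (F ∪ Set.Ioi b) t := by
  intro F hF t ht htd
  have ht1 : t ≤ 1 := by simpa using htd.trans hdim
  have hrpow : ∀ x y : ℝ, 0 ≤ x → 0 ≤ y → ENNReal.ofReal ((x * y) ^ t) =
      ENNReal.ofReal x ^ t * ENNReal.ofReal (y ^ t) := fun x y hx hy => by
    rw [Real.mul_rpow hx hy, ENNReal.ofReal_mul (Real.rpow_nonneg hx t),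
      ENNReal.ofReal_rpow_of_nonneg hx ht.le]
  have hZ : ∀ n, S.Z (F ∪ {b}) t n ≤ S.Z (F ∪ Set.Ioi b) t n := fun n => by
    refine le_trans (ENNReal.tsum_le_tsum fun w => ?_)
      (tsum_pow_count_mul_filter_le (g := fun w => ENNReal.ofReal (S.wnorm w ^ t))
        (C := Set.Ioi b) (b := b) (K := ENNReal.ofReal M ^ t)
        (μ := fun c => ENNReal.ofReal (m c) ^ t) (fun h => lt_irrefl b (hF h)) ?_ ?_ ?_ n [])
    · refine weight_le_pow_count_mul_filter (P := Set.Iio b)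
        (g := fun w => ENNReal.ofReal (S.wnorm w ^ t)) ?_ w.1 [] (by simp)
        fun a ha => Set.union_subset_union_left _ hF (w.2.2 a ha)
      intro p v hp hv
      rw [← hrpow _ _ hM.le (S.wnorm_nonneg_s14 _)]
      exact ENNReal.ofReal_le_ofReal
        (Real.rpow_le_rpow (S.wnorm_nonneg_s14 _) (hMb p v hp hv) ht.le)
    · exact Set.disjoint_left.2 fun a ha hab => lt_asymm (Set.mem_Iio.1 (hF ha)) (Set.mem_Ioi.1 hab)
    · intro c hc p v
      rw [← hrpow _ _ (hm c hc).le (S.wnorm_nonneg_s14 _)]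
      exact ENNReal.ofReal_le_ofReal (Real.rpow_le_rpow
        (mul_nonneg (hm c hc).le (S.wnorm_nonneg_s14 _)) (hmc c hc p v) ht.le)
    · exact (ENNReal.rpow_le_rpow hsum.le ht.le).trans
        (ENNReal.rpow_tsum_le_tsum_rpow _ ht ht1)
  exact Filter.limsup_le_limsup (Filter.Eventually.of_forall fun n =>
    ENNReal.rpow_le_rpow (hZ n) (by positivity))
end

section
/- Suppose Φ is a CGDMS whose incidence matrix A is irreducible. Then for every vertex v ∈ V the limit set J_{E_v} of the associated iterated function system Φ_v is contained in J_v, and moreover the closures coincide: closure(J_{E_v}) = closure(J_v). -/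
open scoped ENNReal

/-- A one-dimensional conformal graph directed Markov system (CGDMS): a finite vertex set
`V`, a countable edge set `E` with initial/terminal vertex maps, nondegenerate compact
intervals `X v ⊂ ℝ`, and injective contractions `φ e : X (term e) → X (init e)` with a
common ratio `s < 1`, each extending to a C¹ map with nowhere-vanishing derivative on a
fixed open interval `W (term e) ⊃ X (term e)` and satisfying a Hölder distortion condition.
The incidence matrix is `A e f = 1 ↔ term e = init f`, so admissibility of words is
expressed directly through `term` and `init`. -/
structure CGDMS (V E : Type*) where
  vfin : Finite V
  init : E → V
  term : E → V
  X : V → Set ℝ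
  hX : ∀ v, ∃ a b : ℝ, a < b ∧ X v = Set.Icc a b
  W : V → Set ℝ
  hWopen : ∀ v, IsOpen (W v)
  hWconn : ∀ v, (W v).OrdConnected
  hXW : ∀ v, X v ⊆ W v
  φ : E → ℝ → ℝ
  s : ℝ
  hs0 : 0 ≤ s
  hs1 : s < 1
  maps : ∀ e, Set.MapsTo (φ e) (X (term e)) (X (init e))
  inj : ∀ e, Set.InjOn (φ e) (X (term e))
  contract : ∀ e, ∀ x ∈ X (term e), ∀ y ∈ X (term e), |φ e x - φ e y| ≤ s * |x - y|
  smooth : ∀ e, ContDiffOn ℝ 1 (φ e) (W (term e))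
  deriv_ne : ∀ e, ∀ x ∈ W (term e), deriv (φ e) x ≠ 0
  L : ℝ
  hL : 1 ≤ L
  β : ℝ
  hβ : 0 < β
  holder : ∀ e, ∀ x ∈ W (term e), ∀ y ∈ W (term e),
    ‖|deriv (φ e) y| - |deriv (φ e) x|‖ ≤
      L * (⨅ z : W (term e), |deriv (φ e) z|) * |y - x| ^ β

namespace CGDMS

variable {V E : Type*} (S : CGDMS V E)

/-- A finite word is `A`-admissible if consecutive edges match: `t(ω_k) = i(ω_{k+1})`. -/
def Adm (w : List E) : Prop := w.Chain' fun e f => S.term e = S.init f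

/-- An infinite word is `A`-admissible if consecutive edges match. -/
def AdmSeq (ω : ℕ → E) : Prop := ∀ n, S.term (ω n) = S.init (ω (n + 1))

/-- The map `φ_ω = φ_{ω_1} ∘ ⋯ ∘ φ_{ω_n}` coded by a finite word `ω`. -/
noncomputable def wordMap (w : List E) : ℝ → ℝ :=
  w.foldr (fun e f => S.φ e ∘ f) id

/-- The domain `X (t(ω))` of the map coded by a nonempty word `ω` (for the empty word we
take the whole space `∪_v X v`). -/
noncomputable def Dom (w : List E) : Set ℝ :=
  match w.getLast? with
  | some e => S.X (S.term e)
  | none => ⋃ v, S.X v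

/-- `‖φ'_ω‖ = sup_{x ∈ X (t(ω))} |φ'_ω(x)|`. -/
noncomputable def wnorm (w : List E) : ℝ :=
  ⨆ x : S.Dom w, |deriv (S.wordMap w) x|

/-- The distortion constant `K_ω = sup_{x,y ∈ X (t(ω))} |φ'_ω(x)| / |φ'_ω(y)|`. -/
noncomputable def Kdist (w : List E) : ℝ :=
  ⨆ x : S.Dom w, ⨆ y : S.Dom w, |deriv (S.wordMap w) x| / |deriv (S.wordMap w) y|

/-- The limit set `J = π(E_A^∞)`: points lying in every image
`φ_{ω_1⋯ω_n}(X (t(ω_n)))` along some admissible infinite word `ω`. -/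
noncomputable def J : Set ℝ :=
  {x | ∃ ω : ℕ → E, S.AdmSeq ω ∧
    ∀ n : ℕ, x ∈ S.wordMap ((List.range (n + 1)).map ω) '' S.X (S.term (ω n))}

/-- `J_v = π({ω ∈ E_A^∞ : i(ω_1) = v})`. -/
noncomputable def Jv (v : V) : Set ℝ :=
  {x | ∃ ω : ℕ → E, S.AdmSeq ω ∧ S.init (ω 0) = v ∧
    ∀ n : ℕ, x ∈ S.wordMap ((List.range (n + 1)).map ω) '' S.X (S.term (ω n))}

/-- A loop at the vertex `v`: a nonempty admissible word starting and ending at `v`. -/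
def IsLoopAt (v : V) (w : List E) : Prop :=
  S.Adm w ∧ (∃ e, w.head? = some e ∧ S.init e = v) ∧
    (∃ f, w.getLast? = some f ∧ S.term f = v)

/-- A first-return loop at `v`: a loop at `v` no proper nonempty initial segment of which
is itself a loop at `v`. -/
def FirstReturnLoop (v : V) (w : List E) : Prop :=
  S.IsLoopAt v w ∧ ∀ k, 0 < k → k < w.length → ¬S.IsLoopAt v (w.take k)

/-- The alphabet `E_v` of the associated iterated function system `Φ_v`: all first-return
loops at `v`. -/
def Ev (v : V) : Set (List E) := {w | S.FirstReturnLoop v w}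

/-- The limit set `J_{E_v} = π(E_v^∞)` of the associated iterated function system `Φ_v`:
points lying in every image `φ_{τ_1 ⋯ τ_n}(X v)` along some infinite sequence of
first-return loops at `v`. -/
noncomputable def JEv (v : V) : Set ℝ :=
  {x | ∃ τ : ℕ → List E, (∀ n, τ n ∈ S.Ev v) ∧
    ∀ n : ℕ, x ∈ S.wordMap (((List.range (n + 1)).map τ).flatten) '' S.X v}

/-- The partition function `Σ_{ω ∈ E_A^n} ‖φ'_ω‖^t ∈ [0,∞]`. -/
noncomputable def Zfun (t : ℝ) (n : ℕ) : ℝ≥0∞ :=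
  ∑' w : {w : List E // w.length = n ∧ S.Adm w}, ENNReal.ofReal (S.wnorm w ^ t)

/-- The topological pressure `P(t) = lim_n (1/n) log Σ_{ω ∈ E_A^n} ‖φ'_ω‖^t ∈ [−∞,∞]`
(the limit is realised here as a limit superior). -/
noncomputable def pressure (t : ℝ) : EReal :=
  Filter.atTop.limsup fun n : ℕ => (((n : ℝ)⁻¹ : ℝ) : EReal) * ENNReal.log (S.Zfun t n)

/-- The partition function of the associated system `Φ_v`, where a word over the alphabet
`E_v` of length `n` is a list of `n` first-return loops at `v`. -/
noncomputable def ZfunV (v : V) (t : ℝ) (n : ℕ) : ℝ≥0∞ :=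
  ∑' w : {w : List (List E) // w.length = n ∧ ∀ u ∈ w, u ∈ S.Ev v},
    ENNReal.ofReal (S.wnorm w.val.flatten ^ t)

/-- The topological pressure `P_{E_v}(t)` of the associated system `Φ_v`, the length of a
word over `E_v` being its number of `E_v`-letters. -/
noncomputable def pressureV (v : V) (t : ℝ) : EReal :=
  Filter.atTop.limsup fun n : ℕ =>
    (((n : ℝ)⁻¹ : ℝ) : EReal) * ENNReal.log (S.ZfunV v t n)

/-- `θ = inf{t ≥ 0 : P(t) < ∞}`. -/
noncomputable def theta : ℝ := sInf {t : ℝ | 0 ≤ t ∧ S.pressure t < ⊤}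

/-- `θ_{E_v} = inf{t ≥ 0 : P_{E_v}(t) < ∞}`. -/
noncomputable def thetaV (v : V) : ℝ := sInf {t : ℝ | 0 ≤ t ∧ S.pressureV v t < ⊤}

/-- The incidence matrix is irreducible: any two edges can be admissibly joined. -/
def Irreducible : Prop := ∀ e f : E, ∃ w : List E, S.Adm (e :: w ++ [f])

/-- The incidence matrix is finitely irreducible: any two edges can be admissibly joined
by a word from one fixed finite set. -/
def FinIrreducible : Prop :=
  ∃ Ω : Finset (List E), ∀ e f : E, ∃ w ∈ Ω, S.Adm (e :: w ++ [f])

end CGDMS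

namespace CGDMS

variable {V E : Type*} (S : CGDMS V E)

/-- `S.Path u w v` says that the word `w` is an edge path from `u` to `v`; the empty word is a
path from each vertex to itself. -/
def Path (u : V) : List E → V → Prop
  | [], v => u = v
  | e :: w, v => S.init e = u ∧ Path (S.term e) w v

variable {S}

theorem Path.append {u m v : V} {a b : List E} (ha : S.Path u a m) (hb : S.Path m b v) :
    S.Path u (a ++ b) v := by
  induction a generalizing u with
  | nil => cases ha; exact hb
  | cons e a ih => exact ⟨ha.1, ih ha.2⟩

theorem path_append {u v : V} {a b : List E} :
    S.Path u (a ++ b) v ↔ ∃ m, S.Path u a m ∧ S.Path m b v := by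
  refine ⟨fun h => ?_, fun ⟨m, ha, hb⟩ => ha.append hb⟩
  induction a generalizing u with
  | nil => exact ⟨u, rfl, h⟩
  | cons e a ih =>
    obtain ⟨m, h₁, h₂⟩ := ih h.2
    exact ⟨m, ⟨h.1, h₁⟩, h₂⟩

theorem Path.unique {u v v' : V} {w : List E} (h : S.Path u w v) (h' : S.Path u w v') :
    v = v' := by
  induction w generalizing u with
  | nil => exact h.symm.trans h'
  | cons e w ih => exact ih h.2 h'.2

theorem Path.drop {u m v : V} {w : List E} (h : S.Path u w v) {k : ℕ}
    (hk : S.Path u (w.take k) m) : S.Path m (w.drop k) v := by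
  rw [← List.take_append_drop k w] at h
  obtain ⟨m', h₁, h₂⟩ := path_append.1 h
  rwa [hk.unique h₁]

theorem adm_iff_isChain {w : List E} :
    S.Adm w ↔ w.IsChain fun e f => S.term e = S.init f :=
  Iff.rfl

theorem path_cons_iff {u v : V} {e : E} {w : List E} :
    S.Path u (e :: w) v ↔
      S.Adm (e :: w) ∧ S.init e = u ∧ ∃ f, (e :: w).getLast? = some f ∧ S.term f = v := by
  induction w generalizing e u with
  | nil => simp [Path, adm_iff_isChain]
  | cons f w ih =>
    rw [Path, ih]
    simp only [adm_iff_isChain, List.isChain_cons_cons, List.getLast?_cons_cons]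
    grind

theorem isLoopAt_iff {v : V} {w : List E} : S.IsLoopAt v w ↔ w ≠ [] ∧ S.Path v w v := by
  cases w with
  | nil => simp [IsLoopAt]
  | cons e w => simp [IsLoopAt, path_cons_iff]

theorem Irreducible.exists_path (hirr : S.Irreducible) (e f : E) :
    ∃ w, S.Path (S.term e) w (S.init f) := by
  obtain ⟨w, hw⟩ := hirr e f
  have h : S.Path (S.init e) (e :: (w ++ [f])) (S.term f) :=
    path_cons_iff.2 ⟨hw, rfl, f, by simp [List.getLast?_cons], rfl⟩
  obtain ⟨m, h₁, h₂⟩ := path_append.1 h.2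
  exact ⟨w, h₂.1 ▸ h₁⟩

theorem AdmSeq.path {ω : ℕ → E} (hω : S.AdmSeq ω) (n : ℕ) :
    S.Path (S.init (ω 0)) ((List.range (n + 1)).map ω) (S.term (ω n)) := by
  induction n with
  | zero => exact ⟨rfl, rfl⟩
  | succ n ih =>
    rw [List.range_succ, List.map_append]
    exact ih.append ⟨(hω n).symm, rfl⟩

theorem Path.exists_flatten {v : V} {w : List E} (h : S.Path v w v) :
    ∃ l : List (List E), (∀ τ ∈ l, τ ∈ S.Ev v) ∧ l.flatten = w := by
  induction hn : w.length using Nat.strong_induction_on generalizing w with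
  | _ n ih =>
    by_cases hw : w = []
    · exact ⟨[], by simp, hw.symm⟩
    classical
    have hex : ∃ k, 0 < k ∧ S.IsLoopAt v (w.take k) :=
      ⟨w.length, List.length_pos_iff.2 hw, by rw [List.take_length]; exact isLoopAt_iff.2 ⟨hw, h⟩⟩
    obtain ⟨hpos, hloop⟩ := Nat.find_spec hex
    have hmin : ∀ j < Nat.find hex, 0 < j → ¬ S.IsLoopAt v (w.take j) :=
      fun j hj hj0 hl => Nat.find_min hex hj ⟨hj0, hl⟩
    set k := Nat.find hex
    have hlen : 0 < w.length := List.length_pos_iff.2 hw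
    obtain ⟨l, hl, hflat⟩ := ih (w.drop k).length (by rw [List.length_drop]; omega)
      (h.drop (isLoopAt_iff.1 hloop).2) rfl
    refine ⟨w.take k :: l, ?_, by simp [hflat]⟩
    simp only [List.mem_cons, forall_eq_or_imp]
    refine ⟨⟨hloop, fun j hj hjk => ?_⟩, hl⟩
    rw [List.length_take] at hjk
    rw [List.take_take, min_eq_left (by omega)]
    exact hmin j (by omega) hj

theorem path_flatten {v : V} {l : List (List E)} (hl : ∀ τ ∈ l, τ ∈ S.Ev v) :
    S.Path v l.flatten v := by
  induction l with
  | nil => rfl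
  | cons τ l ih =>
    simp only [List.mem_cons, forall_eq_or_imp] at hl
    exact (isLoopAt_iff.1 hl.1.1).2.append (ih hl.2)

theorem wordMap_append (a b : List E) : S.wordMap (a ++ b) = S.wordMap a ∘ S.wordMap b := by
  induction a with
  | nil => rfl
  | cons e a ih =>
    change S.φ e ∘ S.wordMap (a ++ b) = (S.φ e ∘ S.wordMap a) ∘ S.wordMap b
    rw [ih, Function.comp_assoc]

theorem Path.mapsTo {u v : V} {w : List E} (h : S.Path u w v) :
    Set.MapsTo (S.wordMap w) (S.X v) (S.X u) := by
  induction w generalizing u with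
  | nil => cases h; exact Set.mapsTo_id _
  | cons e w ih =>
    obtain ⟨rfl, h⟩ := h
    exact (S.maps e).comp (ih h)

theorem Path.abs_sub_le {u v : V} {w : List E} (h : S.Path u w v) {x y : ℝ}
    (hx : x ∈ S.X v) (hy : y ∈ S.X v) :
    |S.wordMap w x - S.wordMap w y| ≤ S.s ^ w.length * |x - y| := by
  induction w generalizing u with
  | nil => simp [wordMap]
  | cons e w ih =>
    calc |S.φ e (S.wordMap w x) - S.φ e (S.wordMap w y)|
        ≤ S.s * |S.wordMap w x - S.wordMap w y| :=
          S.contract e _ (h.2.mapsTo hx) _ (h.2.mapsTo hy)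
      _ ≤ S.s * (S.s ^ w.length * |x - y|) := mul_le_mul_of_nonneg_left (ih h.2) S.hs0
      _ = S.s ^ (e :: w).length * |x - y| := by rw [List.length_cons, pow_succ]; ring

theorem Path.continuousOn {u v : V} {w : List E} (h : S.Path u w v) :
    ContinuousOn (S.wordMap w) (S.X v) := by
  refine (LipschitzOnWith.of_dist_le_mul (K := ⟨S.s ^ w.length, pow_nonneg S.hs0 _⟩)
    fun x hx y hy => ?_).continuousOn
  rw [Real.dist_eq, Real.dist_eq]
  exact h.abs_sub_le hx hy

variable (S)

theorem isCompact_X (v : V) : IsCompact (S.X v) := by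
  obtain ⟨a, b, -, h⟩ := S.hX v
  rw [h]
  exact isCompact_Icc

theorem nonempty_X (v : V) : (S.X v).Nonempty := by
  obtain ⟨a, b, hab, h⟩ := S.hX v
  rw [h]
  exact Set.nonempty_Icc.2 hab.le

theorem exists_abs_sub_le : ∃ D : ℝ, ∀ v, ∀ x ∈ S.X v, ∀ y ∈ S.X v, |x - y| ≤ D := by
  have := S.vfin
  obtain ⟨D, hD⟩ := (Set.finite_range fun v => Metric.diam (S.X v)).bddAbove
  refine ⟨D, fun v x hx y hy => ?_⟩
  rw [← Real.dist_eq]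
  exact (Metric.dist_le_diam_of_mem (S.isCompact_X v).isBounded hx hy).trans (hD ⟨v, rfl⟩)

variable {S}

theorem flatten_map_range_succ (τ : ℕ → List E) (n : ℕ) :
    ((List.range (n + 1)).map τ).flatten = ((List.range n).map τ).flatten ++ τ n := by
  simp [List.range_succ]

theorem path_flatten_map_range {v : V} {τ : ℕ → List E} (hτ : ∀ n, τ n ∈ S.Ev v) (n : ℕ) :
    S.Path v ((List.range n).map τ).flatten v :=
  path_flatten fun w hw => by
    obtain ⟨k, -, rfl⟩ := List.mem_map.1 hw
    exact hτ k

theorem le_length_flatten_map_range {v : V} {τ : ℕ → List E} (hτ : ∀ n, τ n ∈ S.Ev v) (n : ℕ) :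
    n ≤ ((List.range n).map τ).flatten.length := by
  induction n with
  | zero => exact Nat.zero_le _
  | succ n ih =>
    rw [flatten_map_range_succ, List.length_append]
    have := List.length_pos_iff.2 (isLoopAt_iff.1 (hτ n).1).1
    omega

theorem isPrefix_flatten_map_range (τ : ℕ → List E) {m n : ℕ} (h : m ≤ n) :
    ((List.range m).map τ).flatten <+: ((List.range n).map τ).flatten := by
  induction n, h using Nat.le_induction with
  | base => exact List.prefix_rfl
  | succ n _ ih =>
    rw [flatten_map_range_succ]
    exact ih.trans (List.prefix_append _ _)

/-- Every sequence of first-return loops codes a point. -/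
theorem exists_forall_mem_image {v : V} {τ : ℕ → List E} (hτ : ∀ n, τ n ∈ S.Ev v) :
    ∃ x, ∀ n : ℕ, x ∈ S.wordMap (((List.range n).map τ).flatten) '' S.X v := by
  have hcomp (n : ℕ) : IsCompact (S.wordMap (((List.range n).map τ).flatten) '' S.X v) :=
    (S.isCompact_X v).image_of_continuousOn (path_flatten_map_range hτ n).continuousOn
  obtain ⟨x, hx⟩ := IsCompact.nonempty_iInter_of_sequence_nonempty_isCompact_isClosed
    (fun n => S.wordMap (((List.range n).map τ).flatten) '' S.X v)
    (fun n => by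
      rw [flatten_map_range_succ, wordMap_append, Set.image_comp]
      exact Set.image_mono (isLoopAt_iff.1 (hτ n).1).2.mapsTo.image_subset)
    (fun n => (S.nonempty_X v).image _) (hcomp 0) (fun n => (hcomp n).isClosed)
  exact ⟨x, Set.mem_iInter.1 hx⟩

theorem JEv_subset_Jv (v : V) : S.JEv v ⊆ S.Jv v := by
  rintro x ⟨τ, hτ, hx⟩
  set F : ℕ → List E := fun n => ((List.range n).map τ).flatten
  have hlen (n : ℕ) : n < (F (n + 1)).length := le_length_flatten_map_range hτ (n + 1)
  set ω : ℕ → E := fun n => (F (n + 1))[n]'(hlen n) with hω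
  have htake (n : ℕ) : (F n).take n = (List.range n).map ω := by
    refine List.ext_getElem ?_ fun i hi hi' => ?_
    · rw [List.length_take, List.length_map, List.length_range]
      exact min_eq_left (le_length_flatten_map_range hτ n)
    · have hin : i < n := by simpa using hi'
      simp only [List.getElem_take, List.getElem_map, List.getElem_range, hω]
      exact ((isPrefix_flatten_map_range τ (Nat.succ_le_of_lt hin)).getElem (hlen i)).symm
  have hdec (n : ℕ) : F n = (List.range n).map ω ++ (F n).drop n := by
    rw [← htake, List.take_append_drop]
  have hpath (n : ℕ) : ∃ m, S.Path v ((List.range n).map ω) m ∧ S.Path m ((F n).drop n) v :=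
    path_append.1 (hdec n ▸ path_flatten_map_range hτ n)
  have hlast {n : ℕ} {m : V} (h : S.Path v ((List.range (n + 1)).map ω) m) :
      S.Path v ((List.range n).map ω) (S.init (ω n)) ∧ S.term (ω n) = m := by
    rw [List.range_succ, List.map_append] at h
    obtain ⟨m', h₁, h₂, h₃⟩ := path_append.1 h
    exact ⟨h₂ ▸ h₁, h₃⟩
  refine ⟨ω, fun n => ?_, ?_, fun n => ?_⟩
  · obtain ⟨m, hm, -⟩ := hpath (n + 2)
    exact (hlast (hlast hm).1).2
  · obtain ⟨m, hm, -⟩ := hpath 1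
    exact (hlast hm).1.symm
  · obtain ⟨m, hm, hm'⟩ := hpath (n + 1)
    rw [(hlast hm).2]
    have := hx n
    change x ∈ S.wordMap (F (n + 1)) '' S.X v at this
    rw [hdec, wordMap_append, Set.image_comp] at this
    exact Set.image_mono hm'.mapsTo.image_subset this

/-- A nonempty loop at `v` is an initial segment of the coding of a point of `J_{E_v}`. -/
theorem Path.exists_mem_JEv {v : V} {w : List E} (hw : w ≠ []) (h : S.Path v w v) :
    ∃ y ∈ S.JEv v, y ∈ S.wordMap w '' S.X v := by
  obtain ⟨l, hl, rfl⟩ := h.exists_flatten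
  obtain _ | ⟨τ₀, l⟩ := l
  · exact absurd rfl hw
  set τ : ℕ → List E := fun n => (τ₀ :: l).getD n τ₀ with hτdef
  have hτ (n : ℕ) : τ n ∈ S.Ev v := by
    simp only [hτdef, List.getD_eq_getElem?_getD]
    rcases lt_or_ge n (τ₀ :: l).length with hn | hn
    · rw [List.getElem?_eq_getElem hn]
      exact hl _ (List.getElem_mem hn)
    · rw [List.getElem?_eq_none hn]
      exact hl _ List.mem_cons_self
  obtain ⟨y, hy⟩ := exists_forall_mem_image hτ
  refine ⟨y, ⟨τ, hτ, fun n => hy (n + 1)⟩, ?_⟩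
  have hmap : (List.range (τ₀ :: l).length).map τ = τ₀ :: l := by
    refine List.ext_getElem (by simp) fun i hi hi' => ?_
    simp only [List.getElem_map, List.getElem_range, hτdef]
    exact List.getD_eq_getElem _ _ hi'
  simpa only [hmap] using hy (τ₀ :: l).length

theorem Jv_subset_closure_JEv (hirr : S.Irreducible) (v : V) : S.Jv v ⊆ closure (S.JEv v) := by
  rintro x ⟨ω, hω, rfl, hx⟩
  obtain ⟨D, hD⟩ := S.exists_abs_sub_le
  refine Metric.mem_closure_iff.2 fun ε hε => ?_
  have htend : Filter.Tendsto (fun n => S.s ^ (n + 1) * D) Filter.atTop (nhds 0) := by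
    simpa using ((tendsto_pow_atTop_nhds_zero_of_lt_one S.hs0 S.hs1).comp
      (Filter.tendsto_add_atTop_nat 1)).mul_const D
  obtain ⟨n, hn⟩ := (htend.eventually_lt_const hε).exists
  obtain ⟨w, hw⟩ := hirr.exists_path (ω n) (ω 0)
  obtain ⟨y, hy, z, hz, rfl⟩ := ((hω.path n).append hw).exists_mem_JEv (by simp)
  refine ⟨_, hy, ?_⟩
  obtain ⟨x', hx', rfl⟩ := hx n
  rw [wordMap_append, Function.comp_apply, Real.dist_eq]
  refine ((hω.path n).abs_sub_le hx' (hw.mapsTo hz)).trans_lt (lt_of_le_of_lt ?_ hn)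
  rw [List.length_map, List.length_range]
  exact mul_le_mul_of_nonneg_left (hD _ _ hx' _ (hw.mapsTo hz)) (pow_nonneg S.hs0 _)

end CGDMS

/-- Proposition 6.1: if the incidence matrix of the CGDMS `Φ` is irreducible, then for
every vertex `v` the limit set `J_{E_v}` of the associated IFS `Φ_v` is contained in
`J_v`, and the closures coincide: `cl(J_{E_v}) = cl(J_v)`. -/
theorem CGDMS.closure_JEv_eq_closure_Jv {V E : Type*} (S : CGDMS V E)
    (hirr : S.Irreducible) :
    ∀ v : V, S.JEv v ⊆ S.Jv v ∧ closure (S.JEv v) = closure (S.Jv v) := by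
  exact fun v => ⟨JEv_subset_Jv v,
    (closure_mono (JEv_subset_Jv v)).antisymm
      (closure_minimal (Jv_subset_closure_JEv hirr v) isClosed_closure)⟩
end
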